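/- Let D be a byte pair dictionary and w a string with 𝕋^D(w) = τ₁⌢…⌢τₖ, where each τᵢ is a (contiguous, possibly multi-token) subtokenization of the whole tokenization. Then 𝕋^D(π(τᵢ)) = τᵢ for every i ∈ {1,…,k}. -/

import Mathlib

/-!
Formalization of byte pair encoding (BPE) tokenization semantics.

* The alphabet is a type `α`.
* A *token* is a (intended nonempty) string over `α`, i.e. a `List α`.
* A *tokenization* is a finite sequence of tokens.
* A *byte pair dictionary* is a finite sequence of rules (pairs of tokens),
  listed in order of decreasing priority.
-/

/-- A token: a string over the alphabet `α`. -/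
abbrev Token (α : Type*) := List α

/-- A tokenization: a finite sequence of tokens. -/
abbrev Tok (α : Type*) := List (Token α)

/-- A byte pair dictionary: a finite sequence of rules, in decreasing priority order. -/
abbrev Dict (α : Type*) := List (Token α × Token α)

variable {α : Type*}

/-- `π`: concatenation of the tokens of a tokenization. -/
def pi (τ : Tok α) : List α := τ.flatten

/-- All tokens of a tokenization are nonempty strings. -/
def NETok (τ : Tok α) : Prop := ∀ u ∈ τ, u ≠ []

/-- All rules of a dictionary consist of nonempty tokens. -/
def NEDict (D : Dict α) : Prop := ∀ r ∈ D, r.1 ≠ [] ∧ r.2 ≠ []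

/-- `Tk∅(w)`: the initial tokenization of `w` into single symbols. -/
def TkEmpty (w : List α) : Tok α := w.map (fun a => [a])

/-- Rule `r` applies in tokenization `τ` at position `p`
(i.e. `τ = φ ⌢ r.1 ⌢ r.2 ⌢ φ'` with `|φ| = p`). -/
def AppliesAt (r : Token α × Token α) (τ : Tok α) (p : ℕ) : Prop :=
  ∃ φ φ' : Tok α, φ.length = p ∧ τ = φ ++ r.1 :: r.2 :: φ'

/-- Rule `r` applies somewhere in tokenization `τ`. -/
def Applies (r : Token α × Token α) (τ : Tok α) : Prop := ∃ p, AppliesAt r τ p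

/-- The result of applying (merging by) rule `r` at position `p` in `τ`. -/
def applyAt (r : Token α × Token α) (τ : Tok α) (p : ℕ) : Tok α :=
  τ.take p ++ (r.1 ++ r.2) :: τ.drop (p + 2)

/-- The base (nondeterministic) rewriting step `τ ⇒ τ'`: some rule of `D`
is applied somewhere in `τ`. -/
def BStep (D : Dict α) (τ τ' : Tok α) : Prop :=
  ∃ (φ φ' : Tok α) (u v : Token α),
    (u, v) ∈ D ∧ τ = φ ++ u :: v :: φ' ∧ τ' = φ ++ (u ++ v) :: φ'

/-- `τ` is a base tokenization of `w`: reachable from `Tk∅(w)` by base steps,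
and no rule of `D` applies to it. -/
def IsBase (D : Dict α) (w : List α) (τ : Tok α) : Prop :=
  Relation.ReflTransGen (BStep D) (TkEmpty w) τ ∧ ∀ τ', ¬ BStep D τ τ'

/-- `BStepN D n τ τ'`: `τ'` is obtained from `τ` by exactly `n` base steps. -/
def BStepN (D : Dict α) : ℕ → Tok α → Tok α → Prop
  | 0 => Eq
  | n + 1 => fun τ τ'' => ∃ τ', BStepN D n τ τ' ∧ BStep D τ' τ''

/-- One SentencePiece step applying the rule of index `i` (highest priority
applicable) at position `p` (leftmost occurrence of that rule). -/
def SPStepAt (D : Dict α) (i p : ℕ) (τ τ' : Tok α) : Prop :=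
  ∃ h : i < D.length,
    AppliesAt (D[i]'h) τ p ∧
    (∀ (j : ℕ) (hj : j < D.length), j < i → ¬ Applies (D[j]'hj) τ) ∧
    (∀ q < p, ¬ AppliesAt (D[i]'h) τ q) ∧
    τ' = applyAt (D[i]'h) τ p

/-- One SentencePiece step: the highest priority applicable rule is applied
at its leftmost occurrence. -/
def SPStep (D : Dict α) (τ τ' : Tok α) : Prop := ∃ i p, SPStepAt D i p τ τ'

/-- One SentencePiece step which applies the rule `r` of `D`. -/
def SPStepRule (D : Dict α) (r : Token α × Token α) (τ τ' : Tok α) : Prop :=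
  ∃ (i p : ℕ) (h : i < D.length), D[i]'h = r ∧ SPStepAt D i p τ τ'

/-- `τ` is the SentencePiece tokenization `𝕋^D(w)` of `w`: reachable from
`Tk∅(w)` by SentencePiece steps, and no further step applies. -/
def IsSP (D : Dict α) (w : List α) (τ : Tok α) : Prop :=
  Relation.ReflTransGen (SPStep D) (TkEmpty w) τ ∧ ∀ τ', ¬ SPStep D τ τ'

/-- One application of rule `r` at its leftmost occurrence. -/
def LeftStep (r : Token α × Token α) (τ τ' : Tok α) : Prop :=
  ∃ p, AppliesAt r τ p ∧ (∀ q < p, ¬ AppliesAt r τ q) ∧ τ' = applyAt r τ p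

/-- Exhaustive application of rule `r`, leftmost first, until it no longer applies. -/
def Exhaust (r : Token α × Token α) (τ τ' : Tok α) : Prop :=
  Relation.ReflTransGen (LeftStep r) τ τ' ∧ ¬ Applies r τ'

/-- One HuggingFace (macro) step using the rule of index `i`: the rule of
index `i` is the highest-priority applicable rule, and it is applied
repeatedly at its leftmost occurrence until it no longer applies. -/
def HFStepAt (D : Dict α) (i : ℕ) (τ τ' : Tok α) : Prop :=
  ∃ h : i < D.length,
    Applies (D[i]'h) τ ∧
    (∀ (j : ℕ) (hj : j < D.length), j < i → ¬ Applies (D[j]'hj) τ) ∧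
    Exhaust (D[i]'h) τ τ'

/-- One HuggingFace (macro) step. -/
def HFStep (D : Dict α) (τ τ' : Tok α) : Prop := ∃ i, HFStepAt D i τ τ'

/-- One HuggingFace (macro) step which uses the rule `r` of `D`. -/
def HFStepRule (D : Dict α) (r : Token α × Token α) (τ τ' : Tok α) : Prop :=
  ∃ (i : ℕ) (h : i < D.length), D[i]'h = r ∧ HFStepAt D i τ τ'

/-- `τ` is the HuggingFace tokenization `𝕋_hf^D(w)` of `w`. -/
def IsHF (D : Dict α) (w : List α) (τ : Tok α) : Prop :=
  Relation.ReflTransGen (HFStep D) (TkEmpty w) τ ∧ ∀ τ', ¬ HFStep D τ τ'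

/-- A dictionary is *proper* if each side of each rule of length `> 1` is
produced by some higher-priority rule. -/
def Proper (D : Dict α) : Prop :=
  ∀ (j : ℕ) (hj : j < D.length),
    (1 < (D[j]'hj).1.length →
      ∃ (i : ℕ) (hi : i < D.length), i < j ∧ (D[j]'hj).1 = (D[i]'hi).1 ++ (D[i]'hi).2) ∧
    (1 < (D[j]'hj).2.length →
      ∃ (i : ℕ) (hi : i < D.length), i < j ∧ (D[j]'hj).2 = (D[i]'hi).1 ++ (D[i]'hi).2)

/-- `max{|uv| : u⌢v ∈ D}`: the maximal total length of a rule of `D`. -/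
def maxPairLen (D : Dict α) : ℕ := (D.map (fun r => (r.1 ++ r.2).length)).foldr max 0

/-- `l` is a sufficient lookahead bound for `D`: whenever `𝕋^D(π(φ)π(τ)) = φ⌢τ` with
`|π(τ)| ≥ l`, appending any further text keeps `φ` as a prefix of the tokenization. -/
def GoodLookahead (D : Dict α) (l : ℕ) : Prop :=
  ∀ φ τ ψ : Tok α, l ≤ (pi τ).length →
    IsSP D (pi φ ++ pi τ) (φ ++ τ) →
    ∃ ψ', IsSP D (pi φ ++ pi τ ++ pi ψ) (φ ++ ψ')

/-- The lookahead constant `l(D)`: the smallest sufficient lookahead bound. -/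
noncomputable def lookaheadConst (D : Dict α) : ℕ := sInf {l | GoodLookahead D l}

theorem AppliesAt.append_right {r : Token α × Token α} {σ : Tok α} {p : ℕ}
    (h : AppliesAt r σ p) (τ : Tok α) : AppliesAt r (σ ++ τ) p := by
  obtain ⟨φ, φ', hp, rfl⟩ := h
  exact ⟨φ, φ' ++ τ, hp, by simp⟩

theorem AppliesAt.append_left {r : Token α × Token α} {τ : Tok α} {p : ℕ}
    (h : AppliesAt r τ p) (σ : Tok α) : AppliesAt r (σ ++ τ) (σ.length + p) := by
  obtain ⟨φ, φ', rfl, rfl⟩ := h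
  exact ⟨σ ++ φ, φ', by simp, by simp⟩

theorem applyAt_length (r : Token α × Token α) (φ φ' : Tok α) :
    applyAt r (φ ++ r.1 :: r.2 :: φ') φ.length = φ ++ (r.1 ++ r.2) :: φ' := by
  simp [applyAt, List.drop_append]

theorem SPStep.pi_eq {D : Dict α} {σ τ : Tok α} (h : SPStep D σ τ) : pi σ = pi τ := by
  obtain ⟨i, p, hi, ⟨φ, φ', rfl, rfl⟩, -, -, rfl⟩ := h
  rw [applyAt_length]
  simp [pi]

/-- A step whose result is split into two blocks takes place inside one of the blocks. -/
theorem SPStep.of_append {D : Dict α} {ρ σ τ : Tok α} (h : SPStep D ρ (σ ++ τ)) :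
    (∃ σ₀, ρ = σ₀ ++ τ ∧ SPStep D σ₀ σ) ∨ ∃ τ₀, ρ = σ ++ τ₀ ∧ SPStep D τ₀ τ := by
  obtain ⟨i, p, hi, ⟨φ, φ', rfl, rfl⟩, hprio, hleft, heq⟩ := h
  rw [applyAt_length] at heq
  rcases List.append_eq_append_iff.mp heq with ⟨χ, rfl, rfl⟩ | ⟨χ, rfl, hχ⟩
  · right
    refine ⟨χ ++ D[i].1 :: D[i].2 :: φ', by simp, i, χ.length, hi, ⟨χ, φ', rfl, rfl⟩, ?_, ?_,
      (applyAt_length ..).symm⟩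
    · rintro j hj hji ⟨q, hq⟩
      exact hprio j hj hji ⟨_, by simpa using hq.append_left σ⟩
    · intro q hqp hq
      exact hleft (σ.length + q) (by simpa using hqp) (by simpa using hq.append_left σ)
  · rcases List.cons_eq_append_iff.mp hχ with ⟨rfl, rfl⟩ | ⟨χ', rfl, rfl⟩
    · right
      refine ⟨D[i].1 :: D[i].2 :: φ', by simp, i, 0, hi, ⟨[], φ', rfl, rfl⟩, ?_, by simp,
        (applyAt_length D[i] [] φ').symm⟩
      rintro j hj hji ⟨q, hq⟩
      exact hprio j hj hji ⟨_, hq.append_left φ⟩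
    · left
      refine ⟨φ ++ D[i].1 :: D[i].2 :: χ', by simp, i, φ.length, hi, ⟨φ, χ', rfl, rfl⟩, ?_, ?_,
        (applyAt_length ..).symm⟩
      · rintro j hj hji ⟨q, hq⟩
        exact hprio j hj hji ⟨q, by simpa using hq.append_right τ⟩
      · intro q hqp hq
        exact hleft q hqp (by simpa using hq.append_right τ)

theorem pi_TkEmpty (w : List α) : pi (TkEmpty w) = w := by
  induction w with
  | nil => rfl
  | cons a w ih => simpa [pi, TkEmpty] using ih

/-- Both blocks of a reachable tokenization are reachable from their own texts. -/
theorem reachable_blocks {D : Dict α} {w : List α} {ρ : Tok α}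
    (h : Relation.ReflTransGen (SPStep D) (TkEmpty w) ρ) {σ τ : Tok α} (hρ : ρ = σ ++ τ) :
    Relation.ReflTransGen (SPStep D) (TkEmpty (pi σ)) σ ∧
      Relation.ReflTransGen (SPStep D) (TkEmpty (pi τ)) τ := by
  induction h generalizing σ τ with
  | refl =>
    obtain ⟨u, v, -, rfl, rfl⟩ := List.map_eq_append_iff.mp hρ
    change Relation.ReflTransGen _ (TkEmpty (pi (TkEmpty u))) (TkEmpty u) ∧
      Relation.ReflTransGen _ (TkEmpty (pi (TkEmpty v))) (TkEmpty v)
    simp only [pi_TkEmpty]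
    exact ⟨.refl, .refl⟩
  | tail _ hstep ih =>
    subst hρ
    rcases hstep.of_append with ⟨σ₀, hσ₀, hs⟩ | ⟨τ₀, hτ₀, hs⟩
    · obtain ⟨h₁, h₂⟩ := ih hσ₀
      exact ⟨hs.pi_eq ▸ h₁.tail hs, h₂⟩
    · obtain ⟨h₁, h₂⟩ := ih hτ₀
      exact ⟨h₁, hs.pi_eq ▸ h₂.tail hs⟩

theorem exists_SPStep_of_applies {D : Dict α} {τ : Tok α} {i : ℕ} (hi : i < D.length)
    (h : Applies D[i] τ) : ∃ τ', SPStep D τ τ' := by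
  classical
  have hex : ∃ j, ∃ hj : j < D.length, Applies D[j] τ := ⟨i, hi, h⟩
  obtain ⟨hj, hjτ⟩ := Nat.find_spec hex
  exact ⟨_, Nat.find hex, Nat.find hjτ, hj, Nat.find_spec hjτ,
    fun k hk hkj hkτ => Nat.find_min hex hkj ⟨hk, hkτ⟩, fun q hq => Nat.find_min hjτ hq, rfl⟩

theorem IsSP.of_append {D : Dict α} {w : List α} {σ τ ψ : Tok α}
    (h : IsSP D w (σ ++ (τ ++ ψ))) : IsSP D (pi τ) τ := by
  refine ⟨(reachable_blocks (reachable_blocks h.1 rfl).2 rfl).1, ?_⟩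
  rintro τ' ⟨i, p, hi, hp, -⟩
  obtain ⟨ρ, hρ⟩ := exists_SPStep_of_applies hi ⟨_, (hp.append_right ψ).append_left σ⟩
  exact h.2 ρ hρ

/-- If `𝕋^D(w) = τ₁⌢…⌢τₖ` (each `τᵢ` a contiguous block of tokens),
then `𝕋^D(π(τᵢ)) = τᵢ` for every `i`. -/
theorem sp_of_block (D : Dict α) (hD : NEDict D) (w : List α)
    (τs : List (Tok α)) (h : IsSP D w τs.flatten) :
    ∀ (i : ℕ) (hi : i < τs.length), IsSP D (pi (τs[i]'hi)) (τs[i]'hi) := by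
  intro i hi
  have hsplit : τs.flatten = (τs.take i).flatten ++ (τs[i] ++ (τs.drop (i + 1)).flatten) := by
    rw [← List.flatten_cons, ← List.drop_eq_getElem_cons hi, ← List.flatten_append,
      List.take_append_drop]
  exact (hsplit ▸ h).of_append
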